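/- Let K1, K2, K3 be positive real numbers. Then there exists a constant c = f(K1,K2,K3) ∈ ℝ, depending only on K1, K2, K3, with the following property. Let (Ω, 𝓕, P) be a probability space with a filtration {𝓕_n}_{n≥0}, let {ξ_n}_{n≥0} be a real-valued process adapted to {𝓕_n}_{n≥0} with ξ_0 a (deterministic) real constant, and suppose that almost surely, for every n: E(ξ_{n+1} | 𝓕_n) ≥ ξ_n + K1 on the event {ξ_n < 0}; E(ξ_{n+1} | 𝓕_n) ≥ ξ_n + K2 on the event {ξ_n ≥ 0}; and |ξ_{n+1} − ξ_n| ≤ K3. Let T ∈ ℝ and let τ = inf{n ∈ ℕ : ξ_n ≥ T} (with inf ∅ = ∞). Then E(τ) ≤ K2⁻¹·|T| − K1⁻¹·ξ_0·1{ξ_0 < 0} − K2⁻¹·ξ_0·1{ξ_0 ≥ 0} + c. -/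

import Mathlib

open MeasureTheory Filter
open scoped ENNReal

/-- The value `a` on the negative half-line and `b` on the nonnegative one. -/
noncomputable def twoRegime (a b x : ℝ) : ℝ := if x < 0 then a else b

lemma measurable_twoRegime (a b : ℝ) : Measurable (twoRegime a b) :=
  Measurable.ite measurableSet_Iio measurable_const measurable_const

lemma exp_neg_mul_le {l k K d : ℝ} (hl : 0 ≤ l) (hlK : l * K ≤ 1) (hlk : l * K ^ 2 ≤ k / 2)
    (hd : |d| ≤ K) : Real.exp (-(l * d)) ≤ 1 - l * d + l * (k / 2) := by
  have h1 : |-(l * d)| ≤ 1 := by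
    rw [abs_neg, abs_mul, abs_of_nonneg hl]
    exact (mul_le_mul_of_nonneg_left hd hl).trans hlK
  have h2 := (abs_le.1 (Real.abs_exp_sub_one_sub_id_le h1)).2
  have h3 : d ^ 2 ≤ K ^ 2 := sq_le_sq' (abs_le.1 hd).1 (abs_le.1 hd).2
  have h4 : (l * d) ^ 2 ≤ l * (k / 2) := by
    calc (l * d) ^ 2 = l * (l * d ^ 2) := by ring
      _ ≤ l * (k / 2) := by gcongr; exact (mul_le_mul_of_nonneg_left h3 hl).trans hlk
  nlinarith

/-- A bounded function whose mean decreases along the process, by at least one near the origin. -/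
lemma exists_bounded_potential {K1 K2 K3 : ℝ} (hK1 : 0 < K1) (hK2 : 0 < K2) (hK3 : 0 < K3) :
    ∃ (g φ : ℝ → ℝ) (L : ℝ), Measurable φ ∧ (∀ x, 0 ≤ φ x ∧ φ x ≤ L) ∧
      (∀ x, 0 ≤ g x ∧ g x ≤ L) ∧
      ∀ x y, |y - x| ≤ K3 →
        g y + (if |x| ≤ K3 then 1 else 0) + φ x * (y - x - twoRegime K1 K2 x) ≤ g x := by
  set k := min K1 K2 with hk
  have hk0 : 0 < k := lt_min hK1 hK2
  set l := min (1 / K3) (k / 2 / K3 ^ 2) with hl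
  have hl0 : 0 < l := lt_min (by positivity) (by positivity)
  have hlK : l * K3 ≤ 1 := (le_div_iff₀ hK3).1 (min_le_left _ _)
  have hlk : l * K3 ^ 2 ≤ k / 2 := (le_div_iff₀ (by positivity)).1 (min_le_right _ _)
  set C := Real.exp (l * K3) * (2 / (l * k)) with hC
  have hC0 : 0 < C := by positivity
  set E := Real.exp (l * (2 * K3)) with hE
  have hE0 : 0 < E := Real.exp_pos _
  refine ⟨fun x => C * min (Real.exp (-(l * x))) E,
    fun x => if x ≤ -(2 * K3) then 0 else C * (l * Real.exp (-(l * x))),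
    C * E + C * (l * E), ?_, fun x => ?_, fun x => ?_, fun x y hxy => ?_⟩
  · exact Measurable.ite measurableSet_Iic measurable_const (by fun_prop)
  · dsimp only
    split_ifs with h
    · exact ⟨le_rfl, by positivity⟩
    · refine ⟨by positivity, ?_⟩
      have : Real.exp (-(l * x)) ≤ E := Real.exp_le_exp.2 (by nlinarith)
      have h2 : C * (l * Real.exp (-(l * x))) ≤ C * (l * E) := by gcongr
      have : 0 < C * E := by positivity
      linarith
  · refine ⟨mul_nonneg hC0.le (le_min (Real.exp_pos _).le hE0.le), ?_⟩
    have h1 : C * min (Real.exp (-(l * x))) E ≤ C * E := by gcongr; exact min_le_right _ _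
    have : 0 < C * (l * E) := by positivity
    linarith
  · dsimp only
    by_cases h : x ≤ -(2 * K3)
    · have hx : ¬ |x| ≤ K3 := fun hx => by linarith [(abs_le.1 hx).1]
      have hEx : E ≤ Real.exp (-(l * x)) := Real.exp_le_exp.2 (by nlinarith)
      rw [if_neg hx, if_pos h, min_eq_right hEx]
      have h1 : C * min (Real.exp (-(l * y))) E ≤ C * E := by gcongr; exact min_le_right _ _
      linarith
    · have hEx : Real.exp (-(l * x)) ≤ E := Real.exp_le_exp.2 (by nlinarith)
      rw [if_neg h, min_eq_left hEx]
      have hkx : k ≤ twoRegime K1 K2 x := by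
        unfold twoRegime
        split_ifs
        exacts [min_le_left _ _, min_le_right _ _]
      set e := Real.exp (-(l * x)) with he
      have he0 : 0 < e := Real.exp_pos _
      have hy : Real.exp (-(l * y)) = e * Real.exp (-(l * (y - x))) := by
        rw [he, ← Real.exp_add]; ring_nf
      have h1 : C * min (Real.exp (-(l * y))) E ≤
          C * (e * (1 - l * (y - x) + l * (k / 2))) := by
        gcongr
        refine (min_le_left _ _).trans ?_
        rw [hy]
        gcongr
        exact exp_neg_mul_le hl0.le hlK hlk hxy
      have h2 : (if |x| ≤ K3 then (1 : ℝ) else 0) ≤ C * e * (l * (k / 2)) := by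
        split_ifs with hx
        · have h3 : 1 ≤ Real.exp (l * K3) * e := by
            rw [he, ← Real.exp_add]
            exact Real.one_le_exp (by nlinarith [(abs_le.1 hx).2])
          have h4 : C * e * (l * (k / 2)) = Real.exp (l * K3) * e := by
            rw [hC]; field_simp
          linarith
        · positivity
      have h5 : C * e * l * k ≤ C * e * l * twoRegime K1 K2 x := by gcongr
      nlinarith

/-- A potential within bounded distance of `x / twoRegime K1 K2 x` whose mean increases by at
least one at every step. -/
lemma exists_potential {K1 K2 K3 : ℝ} (hK1 : 0 < K1) (hK2 : 0 < K2) (hK3 : 0 < K3) :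
    ∃ (W φ : ℝ → ℝ) (L : ℝ), Measurable φ ∧ (∀ x, 0 ≤ φ x ∧ φ x ≤ L) ∧
      (∀ x, W x ≤ twoRegime K1⁻¹ K2⁻¹ x * x ∧ twoRegime K1⁻¹ K2⁻¹ x * x ≤ W x + L) ∧
      ∀ x y, |y - x| ≤ K3 → W x + 1 + φ x * (y - x - twoRegime K1 K2 x) ≤ W y := by
  obtain ⟨g, φ, L, hφm, hφ, hg, hdec⟩ := exists_bounded_potential hK1 hK2 hK3
  have hi1 : 0 < K1⁻¹ := inv_pos.2 hK1
  have hi2 : 0 < K2⁻¹ := inv_pos.2 hK2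
  have hL : 0 ≤ L := (hg 0).1.trans (hg 0).2
  set C := 1 + (K1⁻¹ + K2⁻¹) * K3 with hC
  have hC0 : 0 < C := by positivity
  have hV0 : ∀ x, 0 < twoRegime K1⁻¹ K2⁻¹ x ∧ twoRegime K1⁻¹ K2⁻¹ x ≤ K1⁻¹ + K2⁻¹ := fun x => by
    unfold twoRegime
    split_ifs <;> constructor <;> linarith
  refine ⟨fun x => twoRegime K1⁻¹ K2⁻¹ x * x - C * g x,
    fun x => (if |x| ≤ K3 then 0 else twoRegime K1⁻¹ K2⁻¹ x) + C * φ x,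
    K1⁻¹ + K2⁻¹ + C * L, ?_, fun x => ?_, fun x => ?_, fun x y hxy => ?_⟩
  · exact (Measurable.ite (measurableSet_le (by fun_prop) measurable_const) measurable_const
      (measurable_twoRegime _ _)).add (hφm.const_mul C)
  · have h1 : 0 ≤ C * φ x := mul_nonneg hC0.le (hφ x).1
    have h2 : C * φ x ≤ C * L := mul_le_mul_of_nonneg_left (hφ x).2 hC0.le
    dsimp only
    split_ifs <;> constructor <;> linarith [(hV0 x).1, (hV0 x).2]
  · have h1 : 0 ≤ C * g x := mul_nonneg hC0.le (hg x).1
    have h2 : C * g x ≤ C * L := mul_le_mul_of_nonneg_left (hg x).2 hC0.le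
    constructor <;> dsimp only <;> linarith
  · have hd := mul_le_mul_of_nonneg_left (hdec x y hxy) hC0.le
    obtain ⟨hxy1, hxy2⟩ := abs_le.1 hxy
    dsimp only
    split_ifs at hd ⊢ with hx
    · have h1 : twoRegime K1⁻¹ K2⁻¹ x * x - (K1⁻¹ + K2⁻¹) * K3 ≤ twoRegime K1⁻¹ K2⁻¹ y * y := by
        unfold twoRegime
        split_ifs <;> nlinarith
      nlinarith
    · have h1 : twoRegime K1⁻¹ K2⁻¹ x * x + 1
          + twoRegime K1⁻¹ K2⁻¹ x * (y - x - twoRegime K1 K2 x) = twoRegime K1⁻¹ K2⁻¹ y * y := by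
        have e1 : K1⁻¹ * K1 = 1 := inv_mul_cancel₀ hK1.ne'
        have e2 : K2⁻¹ * K2 = 1 := inv_mul_cancel₀ hK2.ne'
        rcases lt_abs.1 (not_le.1 hx) with hx | hx
        · have hx0 : ¬ x < 0 := by linarith
          have hy0 : ¬ y < 0 := by linarith
          simp only [twoRegime, if_neg hx0, if_neg hy0]
          linear_combination -e2
        · have hx0 : x < 0 := by linarith
          have hy0 : y < 0 := by linarith
          simp only [twoRegime, if_pos hx0, if_pos hy0]
          linear_combination -e1
      nlinarith

/-- The infimum of the times at which `p` holds is at most the number of `n` such that `p` fails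
up to time `n`. -/
lemma iInf_le_tsum_indicator (p : ℕ → Prop) [DecidablePred fun n => ∀ k ≤ n, ¬ p k] :
    (⨅ (n : ℕ) (_ : p n), (n : ℝ≥0∞)) ≤ ∑' n, if ∀ k ≤ n, ¬ p k then 1 else 0 := by
  classical
  by_cases h : ∃ n, p n
  · refine (iInf₂_le _ (Nat.find_spec h)).trans ?_
    refine le_trans (le_of_eq ?_) (ENNReal.sum_le_tsum (Finset.range (Nat.find h)))
    rw [Finset.sum_congr rfl (g := fun _ => 1), Finset.sum_const, Finset.card_range,
      nsmul_eq_mul, mul_one]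
    intro n hn
    exact if_pos fun k hk => Nat.find_min h (hk.trans_lt (Finset.mem_range.1 hn))
  · push Not at h
    simp [h]

/-- Telescoping a sequence stopped when it first leaves `A`. -/
lemma sum_stopped_le {w : ℕ → ℝ} {A : ℕ → Prop} [DecidablePred fun n => ∀ k ≤ n, A k] {B : ℝ}
    (h0 : w 0 ≤ B) (hw : ∀ n, A n → w (n + 1) ≤ B) (N : ℕ) :
    ∑ n ∈ Finset.range N, (if ∀ k ≤ n, A k then w (n + 1) - w n else 0) ≤ B - w 0 := by
  suffices H : ∑ n ∈ Finset.range N, (if ∀ k ≤ n, A k then w (n + 1) - w n else 0) ≤ B - w 0 ∧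
      ((∀ k < N, A k) →
        ∑ n ∈ Finset.range N, (if ∀ k ≤ n, A k then w (n + 1) - w n else 0) = w N - w 0) from H.1
  induction N with
  | zero => simpa using h0
  | succ N ih =>
    rw [Finset.sum_range_succ]
    by_cases h : ∀ k ≤ N, A k
    · rw [if_pos h, ih.2 fun k hk => h k hk.le]
      exact ⟨by linarith [hw N (h N le_rfl)], fun _ => by ring⟩
    · rw [if_neg h, add_zero]
      exact ⟨ih.1, fun h' => absurd (fun k hk => h' k (Nat.lt_succ_of_le hk)) h⟩

lemma integrable_of_bounded_increments {Ω : Type*} {m : MeasurableSpace Ω} {μ : Measure Ω}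
    [IsFiniteMeasure μ] {ξ : ℕ → Ω → ℝ} {K : ℝ} (hξ : ∀ n, Measurable (ξ n))
    (h0 : Integrable (ξ 0) μ) (hK : ∀ n, ∀ᵐ ω ∂μ, |ξ (n + 1) ω - ξ n ω| ≤ K) (n : ℕ) :
    Integrable (ξ n) μ := by
  induction n with
  | zero => exact h0
  | succ n ih =>
    have h : Integrable (fun ω => ξ (n + 1) ω - ξ n ω) μ :=
      Integrable.of_bound ((hξ _).sub (hξ _)).aestronglyMeasurable K (hK n)
    refine (h.add ih).congr (.of_forall fun ω => ?_)
    simp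

lemma integral_mul_sub_nonneg {Ω : Type*} {m m0 : MeasurableSpace Ω} {μ : Measure Ω}
    [IsFiniteMeasure μ] (hm : m ≤ m0) {Z X Y : Ω → ℝ} {L : ℝ} (hZm : Measurable[m] Z)
    (hZ : ∀ ω, 0 ≤ Z ω ∧ Z ω ≤ L) (hX : Integrable X μ) (hY : Integrable Y μ)
    (h : Y ≤ᵐ[μ] μ[X | m]) :
    0 ≤ ∫ ω, Z ω * (X ω - Y ω) ∂μ := by
  have hb : ∀ᵐ ω ∂μ, ‖Z ω‖ ≤ L :=
    .of_forall fun ω => by rw [Real.norm_eq_abs, abs_of_nonneg (hZ ω).1]; exact (hZ ω).2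
  have hZs : AEStronglyMeasurable Z μ := (hZm.mono hm le_rfl).aestronglyMeasurable
  have hZX : Integrable (fun ω => Z ω * X ω) μ := hX.bdd_mul hZs hb
  have hZY : Integrable (fun ω => Z ω * Y ω) μ := hY.bdd_mul hZs hb
  have hZE : Integrable (fun ω => Z ω * (μ[X | m]) ω) μ := integrable_condExp.bdd_mul hZs hb
  have h1 : ∫ ω, Z ω * X ω ∂μ = ∫ ω, Z ω * (μ[X | m]) ω ∂μ := by
    rw [← integral_condExp hm]
    exact integral_congr_ae (condExp_mul_of_stronglyMeasurable_left hZm.stronglyMeasurable hZX hX)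
  have h2 : ∫ ω, Z ω * Y ω ∂μ ≤ ∫ ω, Z ω * (μ[X | m]) ω ∂μ := by
    refine integral_mono_ae hZY hZE ?_
    filter_upwards [h] with ω hω
    exact mul_le_mul_of_nonneg_left hω (hZ ω).1
  simp_rw [mul_sub]
  rw [integral_sub hZX hZY]
  linarith

/-- Burnashev-style bound on the expected hitting time of a process with
two-regime positive drift and bounded increments (Lemma 6 of the paper). -/
theorem expected_hitting_time_bound (K1 K2 K3 : ℝ) (hK1 : 0 < K1) (hK2 : 0 < K2)
    (hK3 : 0 < K3) :
    ∃ c : ℝ, ∀ (Ω : Type) (m : MeasurableSpace Ω) (μ : Measure Ω),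
      IsProbabilityMeasure μ →
      ∀ (𝓕 : Filtration ℕ m) (ξ : ℕ → Ω → ℝ) (x0 : ℝ),
      Adapted 𝓕 ξ →
      ξ 0 = (fun _ => x0) →
      (∀ n : ℕ, ∀ᵐ ω ∂μ,
        (ξ n ω < 0 → ξ n ω + K1 ≤ (μ[ξ (n + 1) | 𝓕 n]) ω) ∧
        (0 ≤ ξ n ω → ξ n ω + K2 ≤ (μ[ξ (n + 1) | 𝓕 n]) ω) ∧
        |ξ (n + 1) ω - ξ n ω| ≤ K3) →
      ∀ T : ℝ,
      ∫⁻ ω, (⨅ (n : ℕ) (_ : T ≤ ξ n ω), (n : ℝ≥0∞)) ∂μ ≤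
        ENNReal.ofReal (K2⁻¹ * |T|
          - K1⁻¹ * x0 * (if x0 < 0 then 1 else 0)
          - K2⁻¹ * x0 * (if 0 ≤ x0 then 1 else 0) + c) := by
  obtain ⟨W, φ, L, hφm, hφ, hW, hstep⟩ := exists_potential hK1 hK2 hK3
  refine ⟨K2⁻¹ * K3 + L, fun Ω m μ hμ 𝓕 ξ x0 hadap h0 hdrift T => ?_⟩
  classical
  have hi1 : 0 < K1⁻¹ := inv_pos.2 hK1
  have hi2 : 0 < K2⁻¹ := inv_pos.2 hK2
  rcases le_or_gt T x0 with hT | hT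
  · have : ∀ ω, (⨅ (n : ℕ) (_ : T ≤ ξ n ω), (n : ℝ≥0∞)) = 0 := fun ω =>
      le_antisymm ((iInf₂_le 0 (by simpa [h0] using hT)).trans (by simp)) zero_le
    simp [this]
  have hξ : ∀ n, Measurable (ξ n) := fun n => (hadap n).mono (𝓕.le n) le_rfl
  have hξi : ∀ n, Integrable (ξ n) μ := integrable_of_bounded_increments hξ
    (by rw [h0]; exact integrable_const _) fun n => (hdrift n).mono fun ω h => h.2.2
  set A : ℕ → Set Ω := fun n => {ω | ∀ k ≤ n, ¬ T ≤ ξ k ω} with hA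
  have hAm : ∀ n, MeasurableSet[𝓕 n] (A n) := fun n => by
    have : A n = ⋂ (k : ℕ) (_ : k ≤ n), {ω | T ≤ ξ k ω}ᶜ := by ext; simp [hA]
    rw [this]
    refine MeasurableSet.iInter fun k => MeasurableSet.iInter fun hk => ?_
    exact 𝓕.mono hk _ ((hadap k) measurableSet_Ici).compl
  set Z : ℕ → Ω → ℝ := fun n => (A n).indicator (fun ω => φ (ξ n ω)) with hZ
  have hZm : ∀ n, Measurable[𝓕 n] (Z n) := fun n =>
    (hφm.comp (hadap n)).indicator (hAm n)
  have hL : 0 ≤ L := (hφ 0).1.trans (hφ 0).2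
  have hZb : ∀ n ω, 0 ≤ Z n ω ∧ Z n ω ≤ L := fun n ω => by
    by_cases h : ω ∈ A n
    · simpa [hZ, h] using hφ (ξ n ω)
    · simpa [hZ, h] using hL
  have hYint : ∀ n, Integrable (fun ω => ξ n ω + twoRegime K1 K2 (ξ n ω)) μ := fun n => by
    refine (hξi n).add (Integrable.of_bound
      ((measurable_twoRegime K1 K2).comp (hξ n)).aestronglyMeasurable (max K1 K2)
      (.of_forall fun ω => ?_))
    simp only [twoRegime]
    split_ifs <;> simp [abs_of_pos, *]
  have hZint : ∀ n, 0 ≤ ∫ ω, Z n ω * (ξ (n + 1) ω - (ξ n ω + twoRegime K1 K2 (ξ n ω))) ∂μ :=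
    fun n => by
      refine integral_mul_sub_nonneg (𝓕.le n) (hZm n) (hZb n) (hξi _) (hYint n) ?_
      filter_upwards [hdrift n] with ω hω
      unfold twoRegime
      split_ifs with h
      exacts [hω.1 h, hω.2.1 (not_lt.1 h)]
  have hZi : ∀ n, Integrable
      (fun ω => Z n ω * (ξ (n + 1) ω - (ξ n ω + twoRegime K1 K2 (ξ n ω)))) μ := fun n =>
    ((hξi _).sub (hYint n)).bdd_mul (c := L) ((hZm n).mono (𝓕.le n) le_rfl).aestronglyMeasurable
      (.of_forall fun ω => by
        rw [Real.norm_eq_abs, abs_of_nonneg (hZb n ω).1]; exact (hZb n ω).2)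
  have hAi : ∀ n, Integrable ((A n).indicator fun _ => (1 : ℝ)) μ := fun n =>
    (integrable_const 1).indicator (𝓕.le n _ (hAm n))
  set B := K2⁻¹ * (|T| + K3) with hB
  have hWB : ∀ y, y ≤ T + K3 → W y ≤ B := fun y hy => by
    refine (hW y).1.trans ?_
    have hT' := le_abs_self T
    unfold twoRegime
    split_ifs with h
    · have : 0 ≤ B := by positivity
      nlinarith
    · exact mul_le_mul_of_nonneg_left (by linarith) hi2.le
  have hpt : ∀ N, ∀ᵐ ω ∂μ, ∑ n ∈ Finset.range N, ((A n).indicator (fun _ => (1 : ℝ)) ω +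
      Z n ω * (ξ (n + 1) ω - (ξ n ω + twoRegime K1 K2 (ξ n ω)))) ≤ B - W x0 := fun N => by
    filter_upwards [ae_all_iff.2 hdrift] with ω hω
    have h0ω : ξ 0 ω = x0 := by rw [h0]
    have hsum := sum_stopped_le (w := fun n => W (ξ n ω)) (A := fun n => ¬ T ≤ ξ n ω) (B := B)
      (hWB _ (by rw [h0ω]; linarith))
      (fun n hn => hWB _ (by linarith [(abs_le.1 (hω n).2.2).2, not_le.1 hn])) N
    rw [h0ω] at hsum
    refine (Finset.sum_le_sum fun n _ => ?_).trans hsum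
    by_cases h : ω ∈ A n
    · have h' : ∀ k ≤ n, ¬ T ≤ ξ k ω := h
      rw [if_pos h']
      simp only [hZ, Set.indicator_of_mem h]
      have := hstep _ _ (hω n).2.2
      linarith
    · have h' : ¬ ∀ k ≤ n, ¬ T ≤ ξ k ω := h
      rw [if_neg h']
      simp [hZ, h]
  have hreal : ∀ N, ∑ n ∈ Finset.range N, μ.real (A n) ≤ B - W x0 := fun N => by
    have hi : ∀ n ∈ Finset.range N, Integrable (fun ω => (A n).indicator (fun _ => (1 : ℝ)) ω +
        Z n ω * (ξ (n + 1) ω - (ξ n ω + twoRegime K1 K2 (ξ n ω)))) μ :=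
      fun n _ => (hAi n).add (hZi n)
    have h1 := integral_mono_ae (integrable_finsetSum _ hi) (integrable_const (B - W x0)) (hpt N)
    rw [integral_finsetSum _ hi] at h1
    simp only [integral_const, probReal_univ, one_smul] at h1
    refine (Finset.sum_le_sum fun n _ => ?_).trans h1
    rw [integral_add (hAi n) (hZi n), integral_indicator_const _ (𝓕.le n _ (hAm n))]
    simpa using hZint n
  have hfin : B - W x0 ≤ K2⁻¹ * |T| - K1⁻¹ * x0 * (if x0 < 0 then 1 else 0)
      - K2⁻¹ * x0 * (if 0 ≤ x0 then 1 else 0) + (K2⁻¹ * K3 + L) := by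
    have := (hW x0).2
    unfold twoRegime at this
    by_cases h : x0 < 0
    · rw [if_pos h] at this
      rw [if_pos h, if_neg (not_le.2 h)]
      linarith
    · rw [if_neg h] at this
      rw [if_neg h, if_pos (not_lt.1 h)]
      linarith
  calc ∫⁻ ω, (⨅ (n : ℕ) (_ : T ≤ ξ n ω), (n : ℝ≥0∞)) ∂μ
      ≤ ∫⁻ ω, ∑' n, (A n).indicator 1 ω ∂μ := by
        refine lintegral_mono fun ω => (iInf_le_tsum_indicator _).trans (le_of_eq ?_)
        exact tsum_congr fun n => by simp only [Set.indicator_apply]; rfl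
    _ = ∑' n, μ (A n) := by
        rw [lintegral_tsum fun n =>
          (measurable_one.indicator (𝓕.le n _ (hAm n))).aemeasurable]
        exact tsum_congr fun n => lintegral_indicator_one (𝓕.le n _ (hAm n))
    _ ≤ _ := by
        refine ENNReal.tsum_le_of_sum_range_le fun N => ?_
        refine le_trans (le_of_eq ?_) (ENNReal.ofReal_le_ofReal ((hreal N).trans hfin))
        rw [ENNReal.ofReal_sum_of_nonneg fun n _ => measureReal_nonneg]
        exact Finset.sum_congr rfl fun n _ => (ofReal_measureReal).symm
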